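/- Let P = ∏_{p prime} 𝔽_p be the direct product over all prime numbers p of the prime fields 𝔽_p = ZMod p, equipped with the pointwise inverse operation, let A be the smallest subring of P closed under this inverse operation, and let I be the ideal of A consisting of all finitely supported elements of A. Then the quotient ring A / I is isomorphic, as a ring, to the field ℚ of rational numbers. -/

import Mathlib

/-- The index type of all prime numbers. -/
abbrev Primes : Type := {p : ℕ // Nat.Prime p}

/-- `P` is the direct product over all primes `p` of the prime fields `ZMod p`. -/
abbrev P : Type := ∀ p : Primes, ZMod p.1

/-- The pointwise (zero-totalized) inverse operation on `P`. -/
def pinv (x : P) : P := fun p => (x p)⁻¹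

/-- `A` is the smallest subring of `P` that is closed under the inverse operation. -/
def A : Subring P := sInf {S : Subring P | ∀ x ∈ S, pinv x ∈ S}

/-- `Ifin` is the ideal of `A` consisting of the finitely supported elements of `A`. -/
def Ifin : Ideal A where
  carrier := {a : A | {q : Primes | (a : P) q ≠ 0}.Finite}
  zero_mem' := by
    show ({q : Primes | ((0 : A) : P) q ≠ 0}).Finite
    have h : {q : Primes | ((0 : A) : P) q ≠ 0} = ∅ := by ext q; simp
    rw [h]
    exact Set.finite_empty
  add_mem' := by
    intro a b ha hb
    refine (ha.union hb).subset ?_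
    intro q hq
    simp only [Set.mem_setOf_eq, Set.mem_union]
    by_contra hcon
    push_neg at hcon
    apply hq
    show ((a : P) + (b : P)) q = 0
    simp [Pi.add_apply, hcon.1, hcon.2]
  smul_mem' := by
    intro c a ha
    refine ha.subset ?_
    intro q hq
    simp only [Set.mem_setOf_eq] at hq ⊢
    intro h0
    apply hq
    show ((c : P) * (a : P)) q = 0
    simp [Pi.mul_apply, h0]

theorem pinv_mem_A {x : P} (hx : x ∈ A) : pinv x ∈ A := by
  rw [A, Subring.mem_sInf] at hx ⊢
  exact fun S hS => hS x (hx S hS)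

theorem mul_pinv_mul_self (x : P) : x * pinv x * x = x := by
  funext p
  have : Fact p.1.Prime := ⟨p.2⟩
  exact mul_inv_mul_cancel (x p)

theorem pinv_mul_mul_pinv (x : P) : pinv x * x * pinv x = pinv x := by
  funext p
  have : Fact p.1.Prime := ⟨p.2⟩
  have h := mul_inv_mul_cancel (x p)⁻¹
  rwa [inv_inv] at h

/-- The inverse operation restricted to `A`. -/
def invA (a : A) : A := ⟨pinv a, pinv_mem_A a.2⟩

theorem mul_invA_mul_self (a : A) : a * invA a * a = a :=
  Subtype.ext (mul_pinv_mul_self a)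

theorem invA_mul_mul_invA (a : A) : invA a * a * invA a = invA a :=
  Subtype.ext (pinv_mul_mul_pinv a)

theorem finite_primes_dvd {n : ℤ} (hn : n ≠ 0) : {q : Primes | (q.1 : ℤ) ∣ n}.Finite := by
  refine Set.Finite.of_finite_image (f := Subtype.val) ?_ Subtype.val_injective.injOn
  refine (Set.finite_Iic n.natAbs).subset ?_
  rintro _ ⟨q, hq, rfl⟩
  exact Nat.le_of_dvd (Int.natAbs_pos.2 hn) (Int.natCast_dvd.1 hq)

theorem isUnit_intCast_quotient {n : ℤ} (hn : n ≠ 0) : IsUnit ((n : ℤ) : A ⧸ Ifin) := by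
  refine IsUnit.of_mul_eq_one (Ideal.Quotient.mk Ifin (invA (n : A))) ?_
  rw [← map_intCast (Ideal.Quotient.mk Ifin), ← map_mul, ← map_one (Ideal.Quotient.mk Ifin),
    Ideal.Quotient.eq]
  refine (finite_primes_dvd hn).subset fun q hq => ?_
  have : Fact q.1.Prime := ⟨q.2⟩
  by_contra h
  refine hq ?_
  change (((n : A) : P) q) * (((n : A) : P) q)⁻¹ - 1 = 0
  have hnq : ((n : A) : P) q = (n : ZMod q.1) := by simp
  rw [hnq, mul_inv_cancel₀, sub_self]
  exact fun h0 => h ((ZMod.intCast_zmod_eq_zero_iff_dvd n q.1).1 h0)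

theorem Ifin_ne_top : Ifin ≠ ⊤ := by
  rw [Ne, Ideal.eq_top_iff_one]
  intro h
  have hfin : {q : Primes | ((1 : A) : P) q ≠ 0}.Finite := h
  have huniv : {q : Primes | ((1 : A) : P) q ≠ 0} = Set.univ := by
    ext q
    have : Fact q.1.Prime := ⟨q.2⟩
    simp
  rw [huniv] at hfin
  have : Infinite Primes := Nat.infinite_setOfPred_prime.to_subtype
  exact Set.infinite_univ hfin

/-- The ring homomorphism from `ℚ` to the quotient of `A` by `Ifin`. -/
noncomputable def ratToQuotient : ℚ →+* A ⧸ Ifin :=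
  IsLocalization.lift (M := nonZeroDivisors ℤ) (g := Int.castRingHom (A ⧸ Ifin))
    fun n => isUnit_intCast_quotient (nonZeroDivisors.ne_zero n.2)

theorem mk_invA_mem_range {a : A} (ha : Ideal.Quotient.mk Ifin a ∈ ratToQuotient.range) :
    Ideal.Quotient.mk Ifin (invA a) ∈ ratToQuotient.range := by
  obtain ⟨r, hr⟩ := ha
  refine ⟨r⁻¹, ?_⟩
  have h₁ := congrArg (Ideal.Quotient.mk Ifin) (mul_invA_mul_self a)
  have h₂ := congrArg (Ideal.Quotient.mk Ifin) (invA_mul_mul_invA a)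
  simp only [map_mul, ← hr] at h₁ h₂
  obtain rfl | h0 := eq_or_ne r 0
  · simpa using h₂
  · have h₃ : ratToQuotient r * ratToQuotient r⁻¹ = 1 := by
      rw [← map_mul, mul_inv_cancel₀ h0, map_one]
    set y := Ideal.Quotient.mk Ifin (invA a)
    linear_combination (-(ratToQuotient r⁻¹) ^ 2) * h₁ +
      (y * (ratToQuotient r * ratToQuotient r⁻¹ + 1) - ratToQuotient r⁻¹) * h₃

theorem ratToQuotient_surjective : Function.Surjective ratToQuotient := by
  intro y
  obtain ⟨a, rfl⟩ := Ideal.Quotient.mk_surjective y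
  let T : Subring P := (ratToQuotient.range.comap (Ideal.Quotient.mk Ifin)).map A.subtype
  have hT : A ≤ T := by
    refine sInf_le ?_
    rintro _ ⟨b, hb, rfl⟩
    exact ⟨invA b, mk_invA_mem_range hb, rfl⟩
  obtain ⟨b, hb, hba⟩ := hT a.2
  obtain rfl : b = a := Subtype.ext hba
  exact hb

/-- the quotient of `A` by the ideal of finitely supported elements is
isomorphic, as a ring, to the field `ℚ` of rational numbers. -/
theorem quotient_iso_rat : Nonempty ((A ⧸ Ifin) ≃+* ℚ) := by
  have : Nontrivial (A ⧸ Ifin) := Ideal.Quotient.nontrivial_iff.2 Ifin_ne_top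
  exact ⟨(RingEquiv.ofBijective ratToQuotient
    ⟨ratToQuotient.injective, ratToQuotient_surjective⟩).symm⟩
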